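/- Let T be a regular s-interval exchange transformation on [ℓ,r) defined over ℤ[√d]. There exist constants 0 < c₁ ≤ c₂ (depending only on T) such that every semi-interval J ∈ U(T) satisfies c₁ ≤ Π(J) ≤ c₂, i.e., Π(J) = Θ(1) for J ∈ U(T). -/

import Mathlib

open Set MeasureTheory

noncomputable section

/-- Left endpoint `γ i` of the `i`-th exchanged semi-interval. -/
def sepPt {s : ℕ} (l : ℝ) (len : Fin s → ℝ) (i : Fin s) : ℝ :=
  l + ∑ j ∈ Finset.univ.filter (fun j => j < i), len j

/-- Left endpoint `δ` of the image of the `i`-th exchanged semi-interval. -/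
def imgPt {s : ℕ} (l : ℝ) (len : Fin s → ℝ) (π : Equiv.Perm (Fin s)) (i : Fin s) : ℝ :=
  l + ∑ j ∈ Finset.univ.filter (fun j => π j < π i), len j

/-- `T` is the `s`-interval exchange transformation on `[l,r)` with lengths `len`
and permutation `π`, extended by the identity outside `[l,r)`. -/
def IsIET (s : ℕ) (l r : ℝ) (len : Fin s → ℝ) (π : Equiv.Perm (Fin s))
    (T : Equiv.Perm ℝ) : Prop :=
  l < r ∧ (∀ i, 0 < len i) ∧ (∑ i, len i) = r - l ∧
  (∀ z, z ∉ Set.Ico l r → T z = z) ∧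
  ∀ i : Fin s, ∀ z ∈ Set.Ico (sepPt l len i) (sepPt l len i + len i),
    T z = z + (imgPt l len π i - sepPt l len i)

/-- The two-sided orbit `{T^n z : n ∈ ℤ}`. -/
def orbitZ (T : Equiv.Perm ℝ) (z : ℝ) : Set ℝ := {w | ∃ n : ℤ, (T ^ n) z = w}

/-- Regularity (idoc): the orbits of the nonzero separation points are infinite
and pairwise disjoint. -/
def IsRegularIET (s : ℕ) (l : ℝ) (len : Fin s → ℝ) (T : Equiv.Perm ℝ) : Prop :=
  (∀ i : Fin s, (i : ℕ) ≠ 0 → (orbitZ T (sepPt l len i)).Infinite) ∧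
  (∀ i j : Fin s, (i : ℕ) ≠ 0 → (j : ℕ) ≠ 0 → i ≠ j →
    Disjoint (orbitZ T (sepPt l len i)) (orbitZ T (sepPt l len j)))

/-- Minimality: every (two-sided) orbit of a point of `[l,r)` is dense in `[l,r)`. -/
def IsMinimalOn (T : Equiv.Perm ℝ) (l r : ℝ) : Prop :=
  ∀ z ∈ Set.Ico l r, Set.Ico l r ⊆ closure (orbitZ T z)

/-- First return time of `z` in `I` (defined via `sInf`; meaningful when `T` is minimal). -/
def returnTime (T : Equiv.Perm ℝ) (I : Set ℝ) (z : ℝ) : ℕ :=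
  sInf {n : ℕ | 0 < n ∧ (T ^ n) z ∈ I}

/-- The transformation induced by `T` on `I` (first-return map). -/
def inducedMap (T : Equiv.Perm ℝ) (I : Set ℝ) (z : ℝ) : ℝ :=
  (T ^ returnTime T I z) z

/-- The transformation induced by `T` on `[u,v)` is an interval exchange
transformation on `k` intervals with data `(lam, σ)`. -/
def InducedData (T : Equiv.Perm ℝ) (u v : ℝ) (k : ℕ) (lam : Fin k → ℝ)
    (σ : Equiv.Perm (Fin k)) : Prop :=
  ∃ S : Equiv.Perm ℝ, IsIET k u v lam σ S ∧
    ∀ z ∈ Set.Ico u v, S z = inducedMap T (Set.Ico u v) z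

/-- The semi-interval `[l,t)` is right admissible for `T`. -/
def RightAdmissible (s : ℕ) (l r : ℝ) (len : Fin s → ℝ) (T : Equiv.Perm ℝ)
    (t : ℝ) : Prop :=
  l < t ∧ t < r ∧ ∃ (i : Fin s) (k : ℤ), t = (T ^ k) (sepPt l len i) ∧
    (0 < k → ∀ h : ℤ, 0 < h → h < k → t < (T ^ h) (sepPt l len i)) ∧
    (k ≤ 0 → ∀ h : ℤ, k < h → h ≤ 0 → t < (T ^ h) (sepPt l len i))

/-- `ρ⁺_{I,T}(z) = min {n > 0 : T^n z ∈ (u,v)}`. -/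
def rhoPlusPt (T : Equiv.Perm ℝ) (u v z : ℝ) : ℕ :=
  sInf {n : ℕ | 0 < n ∧ (T ^ n) z ∈ Set.Ioo u v}

/-- `ρ⁻_{I,T}(z) = min {n ≥ 0 : T^{-n} z ∈ (u,v)}`. -/
def rhoMinusPt (T : Equiv.Perm ℝ) (u v z : ℝ) : ℕ :=
  sInf {n : ℕ | (T⁻¹ ^ n) z ∈ Set.Ioo u v}

/-- The set of neighbours `N_{I,T}(z)` of `z` with respect to `I = [u,v)` and `T`. -/
def neighbours (T : Equiv.Perm ℝ) (u v z : ℝ) : Set ℝ :=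
  {w | ∃ k : ℤ, -(rhoMinusPt T u v z : ℤ) ≤ k ∧ k < (rhoPlusPt T u v z : ℤ) ∧
    w = (T ^ k) z}

/-- The set of division points `Div(I,T)` of `I = [u,v)` with respect to `T`. -/
def divPoints (s : ℕ) (l : ℝ) (len : Fin s → ℝ) (T : Equiv.Perm ℝ)
    (u v : ℝ) : Set ℝ :=
  ⋃ i : Fin s, neighbours T u v (sepPt l len i)

/-- The semi-interval `[u,v) ⊆ [l,r)` is admissible for `T`. -/
def Admissible (s : ℕ) (l r : ℝ) (len : Fin s → ℝ) (T : Equiv.Perm ℝ)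
    (u v : ℝ) : Prop :=
  l ≤ u ∧ u < v ∧ v ≤ r ∧
  u ∈ divPoints s l len T u v ∪ {r} ∧ v ∈ divPoints s l len T u v ∪ {r}

/-- A bundled regular `s`-interval exchange transformation. -/
structure RIET (s : ℕ) where
  l : ℝ
  r : ℝ
  len : Fin s → ℝ
  perm : Equiv.Perm (Fin s)
  T : Equiv.Perm ℝ
  isIET : IsIET s l r len perm T
  isReg : IsRegularIET s l len T

/-- The right endpoint `max (γ_s, δ_{π(s)})` of `Z(T)`. -/
def zPoint {s : ℕ} (X : RIET s) : ℝ :=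
  if h : 0 < s then
    max (sepPt X.l X.len ⟨s - 1, by omega⟩)
      (imgPt X.l X.len X.perm (X.perm.symm ⟨s - 1, by omega⟩))
  else X.r

/-- The left endpoint `min (γ_2, δ_{π(2)})` of `Y(T)`. -/
def yPoint {s : ℕ} (X : RIET s) : ℝ :=
  if h : 1 < s then
    min (sepPt X.l X.len ⟨1, h⟩) (imgPt X.l X.len X.perm (X.perm.symm ⟨1, h⟩))
  else X.l

/-- `Y = ψ(X)`: one step of the right Rauzy induction. -/
def PsiStep {s : ℕ} (X Y : RIET s) : Prop :=
  Y.l = X.l ∧ Y.r = zPoint X ∧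
  ∀ z ∈ Set.Ico X.l (zPoint X), Y.T z = inducedMap X.T (Set.Ico X.l (zPoint X)) z

/-- `Y = φ(X)`: one step of the left Rauzy induction. -/
def PhiStep {s : ℕ} (X Y : RIET s) : Prop :=
  Y.l = yPoint X ∧ Y.r = X.r ∧
  ∀ z ∈ Set.Ico (yPoint X) X.r, Y.T z = inducedMap X.T (Set.Ico (yPoint X) X.r) z

/-- Equivalence of two `s`-interval exchange transformations: `(σ, mu)` is obtained
from `(π, lam)` by rescaling, possibly combined with the reversal `τ : i ↦ s - i + 1`. -/
def IETEquiv (s : ℕ) (π σ : Equiv.Perm (Fin s)) (lam mu : Fin s → ℝ) : Prop :=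
  (∃ c : ℝ, 0 < c ∧ σ = π ∧ ∀ i, mu i = c * lam i) ∨
  (∃ c : ℝ, 0 < c ∧ (∀ i, σ i = (π i).rev) ∧ ∀ i, mu i = c * lam i.rev)

/-- The subring `ℤ[√d]` of `ℝ`. -/
def Zsd (d : ℤ) : Set ℝ := {z | ∃ m n : ℤ, z = (m : ℝ) + (n : ℝ) * Real.sqrt d}

/-- `Ψ(z) = max (|m|,|n|)` for `z = m + n√d` (the representation being unique
when `d ≥ 2` is squarefree). -/
def PsiNum (d : ℤ) (z : ℝ) : ℕ :=
  sInf {k : ℕ | ∃ m n : ℤ, z = (m : ℝ) + (n : ℝ) * Real.sqrt d ∧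
    k = max m.natAbs n.natAbs}

/-- `Ψ(S) = max {Ψ(z) : z ∈ ∂S}`. -/
def PsiSet (d : ℤ) (S : Set ℝ) : ℕ := sSup (PsiNum d '' frontier S)

/-- The reduced complexity `Π(S) = |S| ⬝ Ψ(S)`. -/
def PiSet (d : ℤ) (S : Set ℝ) : ℝ := (volume S).toReal * PsiSet d S

/-- `S` belongs to the algebra `A([l,r))`: a nonempty finite union of semi-intervals
of `[l,r)` with endpoints in `ℤ[√d]`. -/
def MemA (d : ℤ) (l r : ℝ) (S : Set ℝ) : Prop :=
  S.Nonempty ∧ S ⊆ Set.Ico l r ∧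
  ∃ (k : ℕ) (a b : Fin k → ℝ), (∀ j, a j ∈ Zsd d ∧ b j ∈ Zsd d ∧ a j < b j) ∧
    S = ⋃ j, Set.Ico (a j) (b j)

/-- The interval exchange transformation with data `(l, r, len, π)` is defined over
`ℤ[√d]`: `l`, `r`, the separation points and the translation values lie in `ℤ[√d]`. -/
def DefinedOverZ (d : ℤ) (s : ℕ) (l r : ℝ) (len : Fin s → ℝ)
    (π : Equiv.Perm (Fin s)) : Prop :=
  l ∈ Zsd d ∧ r ∈ Zsd d ∧
  ∀ i, sepPt l len i ∈ Zsd d ∧ (imgPt l len π i - sepPt l len i) ∈ Zsd d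

/-- Maximal positive return time `ρ⁺(S)`. -/
def rhoPlusSet (T : Equiv.Perm ℝ) (S : Set ℝ) : ℕ :=
  sInf {n : ℕ | 1 ≤ n ∧ ⇑(T ^ n) '' S ⊆ ⋃ i ∈ Finset.range n, ⇑(T ^ i) '' S}

/-- Maximal negative return time `ρ⁻(S)`. -/
def rhoMinusSet (T : Equiv.Perm ℝ) (S : Set ℝ) : ℕ :=
  sInf {m : ℕ | 1 ≤ m ∧ ⇑(T ^ m) '' S ⊆ ⋃ i ∈ Finset.range m, ⇑(T⁻¹ ^ i) '' S}

/-- Minimal positive return time `σ⁺(S)`. -/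
def sigmaPlusSet (T : Equiv.Perm ℝ) (S : Set ℝ) : ℕ :=
  sInf {n : ℕ | 1 ≤ n ∧ (⇑(T ^ n) '' S ∩ S).Nonempty}

/-- Minimal negative return time `σ⁻(S)`. -/
def sigmaMinusSet (T : Equiv.Perm ℝ) (S : Set ℝ) : ℕ :=
  sInf {m : ℕ | 1 ≤ m ∧ (⇑(T⁻¹ ^ m) '' S ∩ S).Nonempty}

/-- `D_{m,n}(T) = ⋃_{i=-m+1}^{n} T^i (Sep(T))`. -/
def Dmn (s : ℕ) (l : ℝ) (len : Fin s → ℝ) (T : Equiv.Perm ℝ) (m n : ℕ) : Set ℝ :=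
  {w | ∃ (i : Fin s) (k : ℤ), -(m : ℤ) + 1 ≤ k ∧ k ≤ (n : ℤ) ∧
    w = (T ^ k) (sepPt l len i)}

/-- `[u,v)` belongs to `U(T) = ⋃_{m,n ≥ 1} U_{m,n}(T)`: it is one of the
semi-intervals into which `D_{m,n}(T)` partitions `[l,r)`. -/
def MemU (s : ℕ) (l r : ℝ) (len : Fin s → ℝ) (T : Equiv.Perm ℝ) (u v : ℝ) : Prop :=
  ∃ m n : ℕ, 1 ≤ m ∧ 1 ≤ n ∧ u ∈ Dmn s l len T m n ∧
    (v ∈ Dmn s l len T m n ∨ v = r) ∧ ∀ w ∈ Dmn s l len T m n, w ∉ Set.Ioo u v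

/-- The elements `a + b√d` of `ℤ[√d]` with `max |a| |b| ≤ n`. -/
def latBall (d : ℤ) (n : ℕ) : Set ℝ :=
  {z | ∃ a b : ℤ, z = (a : ℝ) + (b : ℝ) * Real.sqrt d ∧ a.natAbs ≤ n ∧ b.natAbs ≤ n}

theorem latBall_mono {d : ℤ} {m n : ℕ} (h : m ≤ n) : latBall d m ⊆ latBall d n := by
  rintro z ⟨a, b, rfl, ha, hb⟩
  exact ⟨a, b, rfl, ha.trans h, hb.trans h⟩

theorem zero_mem_latBall (d : ℤ) (n : ℕ) : (0 : ℝ) ∈ latBall d n :=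
  ⟨0, 0, by simp, by simp, by simp⟩

theorem add_mem_latBall {d : ℤ} {m n : ℕ} {x y : ℝ} (hx : x ∈ latBall d m)
    (hy : y ∈ latBall d n) : x + y ∈ latBall d (m + n) := by
  obtain ⟨a, b, rfl, ha, hb⟩ := hx
  obtain ⟨a', b', rfl, ha', hb'⟩ := hy
  exact ⟨a + a', b + b', by push_cast; ring, by omega, by omega⟩

theorem neg_mem_latBall {d : ℤ} {n : ℕ} {x : ℝ} (hx : x ∈ latBall d n) :
    -x ∈ latBall d n := by
  obtain ⟨a, b, rfl, ha, hb⟩ := hx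
  exact ⟨-a, -b, by push_cast; ring, by omega, by omega⟩

theorem sub_mem_latBall {d : ℤ} {m n : ℕ} {x y : ℝ} (hx : x ∈ latBall d m)
    (hy : y ∈ latBall d n) : x - y ∈ latBall d (m + n) := by
  rw [sub_eq_add_neg]
  exact add_mem_latBall hx (neg_mem_latBall hy)

theorem exists_mem_latBall_of_mem_Zsd {d : ℤ} {z : ℝ} (hz : z ∈ Zsd d) :
    ∃ n, z ∈ latBall d n := by
  obtain ⟨a, b, h⟩ := hz
  exact ⟨max a.natAbs b.natAbs, a, b, h, le_max_left _ _, le_max_right _ _⟩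

theorem mem_Zsd_of_mem_latBall {d : ℤ} {n : ℕ} {z : ℝ} (hz : z ∈ latBall d n) : z ∈ Zsd d := by
  obtain ⟨a, b, h, -, -⟩ := hz
  exact ⟨a, b, h⟩

theorem psiNum_le_of_mem_latBall {d : ℤ} {n : ℕ} {z : ℝ} (hz : z ∈ latBall d n) :
    PsiNum d z ≤ n := by
  obtain ⟨a, b, h, ha, hb⟩ := hz
  unfold PsiNum
  exact le_trans (Nat.sInf_le ⟨a, b, h, rfl⟩) (max_le ha hb)

theorem mem_latBall_psiNum {d : ℤ} {z : ℝ} (hz : z ∈ Zsd d) : z ∈ latBall d (PsiNum d z) := by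
  obtain ⟨a, b, h⟩ := hz
  obtain ⟨a', b', h', hk⟩ := Nat.sInf_mem
    (s := {k : ℕ | ∃ m n : ℤ, z = (m : ℝ) + (n : ℝ) * Real.sqrt d ∧
      k = max m.natAbs n.natAbs}) ⟨_, a, b, h, rfl⟩
  exact ⟨a', b', h', (le_max_left _ _).trans hk.ge, (le_max_right _ _).trans hk.ge⟩

theorem irrational_sqrt_of_squarefree {d : ℤ} (hd : 2 ≤ d) (hsf : Squarefree d) :
    Irrational (Real.sqrt d) := by
  rw [irrational_sqrt_intCast_iff]
  refine ⟨?_, by omega⟩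
  rintro ⟨a, rfl⟩
  have hu := hsf a dvd_rfl
  rcases Int.isUnit_iff.1 hu with h | h <;> subst h <;> norm_num at hd

/-- Positive elements of `ℤ[√d]` of height at most `n` are bounded below by a multiple
of `1 / n`, because their norm is a nonzero integer. -/
theorem one_le_mul_of_mem_latBall {d : ℤ} (hd : 0 ≤ d) (hirr : Irrational (Real.sqrt d)) {n : ℕ}
    {x : ℝ} (hx : x ∈ latBall d n) (hpos : 0 < x) : 1 ≤ x * (n * (1 + Real.sqrt d)) := by
  obtain ⟨a, b, rfl, ha, hb⟩ := hx
  have hs : Real.sqrt d * Real.sqrt d = d := Real.mul_self_sqrt (by exact_mod_cast hd)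
  have hs0 := Real.sqrt_nonneg (d : ℝ)
  have hprod : ((a : ℝ) + b * Real.sqrt d) * (a - b * Real.sqrt d) =
      ((a * a - d * (b * b) : ℤ) : ℝ) := by
    push_cast
    linear_combination (-(b : ℝ) * b) * hs
  have hne : a * a - d * (b * b) ≠ 0 := by
    intro h0
    rw [h0, Int.cast_zero, mul_eq_zero] at hprod
    rcases hprod with h | h
    · exact hpos.ne' h
    · by_cases hb0 : b = 0
      · subst hb0
        simp at h hpos
        exact hpos.ne' (by exact_mod_cast h)
      · apply hirr
        refine ⟨(a : ℚ) / b, ?_⟩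
        have : (b : ℝ) ≠ 0 := by exact_mod_cast hb0
        push_cast
        field_simp
        linarith
  have h1 : (1 : ℝ) ≤ |((a * a - d * (b * b) : ℤ) : ℝ)| := by
    exact_mod_cast Int.one_le_abs hne
  rw [← hprod, abs_mul, abs_of_pos hpos] at h1
  refine h1.trans (mul_le_mul_of_nonneg_left ?_ hpos.le)
  have ha' : |(a : ℝ)| ≤ n := by
    rw [← Int.cast_abs, Int.abs_eq_natAbs]
    exact_mod_cast ha
  have hb' : |(b : ℝ)| ≤ n := by
    rw [← Int.cast_abs, Int.abs_eq_natAbs]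
    exact_mod_cast hb
  calc |(a : ℝ) - b * Real.sqrt d| ≤ |(a : ℝ)| + |(b : ℝ) * Real.sqrt d| := abs_sub _ _
    _ = |(a : ℝ)| + |(b : ℝ)| * Real.sqrt d := by rw [abs_mul, abs_of_nonneg hs0]
    _ ≤ n + n * Real.sqrt d := add_le_add ha' (mul_le_mul_of_nonneg_right hb' hs0)
    _ = n * (1 + Real.sqrt d) := by ring

/-- `f` permutes `[l,r)` and is a translation on every semi-interval whose interior
avoids the finite set `F`. -/
structure PiecewiseTranslation (f : Equiv.Perm ℝ) (l r : ℝ) (F : Set ℝ) : Prop where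
  finite : F.Finite
  mem_iff : ∀ z, f z ∈ Ico l r ↔ z ∈ Ico l r
  trans : ∀ a b, l ≤ a → a < b → b ≤ r → (∀ z ∈ Ioo a b, z ∉ F) →
    ∃ t, ∀ z ∈ Ico a b, f z = z + t

namespace PiecewiseTranslation

variable {f : Equiv.Perm ℝ} {l r : ℝ} {F : Set ℝ}

theorem pow_mem (hf : PiecewiseTranslation f l r F) (k : ℕ) {z : ℝ} (hz : z ∈ Ico l r) :
    (f ^ k) z ∈ Ico l r := by
  induction k with
  | zero => simpa using hz
  | succ k ih =>
    rw [pow_succ', Equiv.Perm.mul_apply, hf.mem_iff]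
    exact ih

theorem pow_trans (hf : PiecewiseTranslation f l r F) {a b : ℝ} (hla : l ≤ a) (hab : a < b)
    (hbr : b ≤ r) {N : ℕ} (hN : ∀ k < N, ∀ z ∈ Ioo a b, (f ^ k) z ∉ F) :
    ∀ k ≤ N, ∃ t, ∀ z ∈ Ico a b, (f ^ k) z = z + t := by
  intro k
  induction k with
  | zero => exact fun _ => ⟨0, by simp⟩
  | succ k ih =>
    intro hk
    obtain ⟨t, ht⟩ := ih (by omega)
    have hsub : ∀ z ∈ Ico a b, z + t ∈ Ico l r := fun z hz => by
      rw [← ht z hz]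
      exact hf.pow_mem k ⟨hla.trans hz.1, hz.2.trans_le hbr⟩
    have h1 : l ≤ a + t := (hsub a ⟨le_rfl, hab⟩).1
    have h2 : b + t ≤ r := by
      by_contra! h
      have hm : max a (r - t) ∈ Ico a b := ⟨le_max_left _ _, max_lt hab (by linarith)⟩
      have := (hsub _ hm).2
      have := le_max_right a (r - t)
      linarith
    obtain ⟨t', ht'⟩ := hf.trans (a + t) (b + t) h1 (by linarith) h2 (by
      intro z hz hzF
      have hz' : z - t ∈ Ioo a b := ⟨by linarith [hz.1], by linarith [hz.2]⟩
      apply hN k (by omega) _ hz'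
      rw [ht _ ⟨hz'.1.le, hz'.2⟩]
      simpa using hzF)
    refine ⟨t + t', fun z hz => ?_⟩
    rw [pow_succ', Equiv.Perm.mul_apply, ht z hz, ht' _ ⟨by linarith [hz.1], by linarith [hz.2]⟩]
    ring

theorem continuousAt (hf : PiecewiseTranslation f l r F) {w : ℝ} (hw : w ∈ Ioo l r)
    (hwF : w ∉ F) : ContinuousAt f w ∧ f w ∈ Ioo l r := by
  have hopen : Ioo l r ∩ Fᶜ ∈ nhds w :=
    (isOpen_Ioo.inter hf.finite.isClosed.isOpen_compl).mem_nhds ⟨hw, hwF⟩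
  obtain ⟨ε, hε, hball⟩ := Metric.mem_nhds_iff.1 hopen
  rw [Real.ball_eq_Ioo] at hball
  have hsub : ∀ z ∈ Ioo (w - ε) (w + ε), z ∈ Ioo l r ∧ z ∉ F := fun z hz => hball hz
  obtain ⟨t, ht⟩ := hf.trans (w - ε / 2) (w + ε / 2)
    (hsub (w - ε / 2) ⟨by linarith, by linarith⟩).1.1.le (by linarith)
    (hsub (w + ε / 2) ⟨by linarith, by linarith⟩).1.2.le
    (fun z hz => (hsub z ⟨by linarith [hz.1], by linarith [hz.2]⟩).2)
  have hev : ∀ᶠ z in nhds w, z + t = f z := by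
    filter_upwards [Ioo_mem_nhds (show w - ε / 2 < w by linarith)
      (show w < w + ε / 2 by linarith)] with z hz
    exact (ht z ⟨hz.1.le, hz.2⟩).symm
  refine ⟨ContinuousAt.congr (by fun_prop) hev, ?_, ?_⟩
  · have h1 : f (w - ε / 2) ∈ Ico l r := by
      rw [hf.mem_iff]
      exact Ioo_subset_Ico_self (hsub _ ⟨by linarith, by linarith⟩).1
    rw [ht _ ⟨le_rfl, by linarith⟩] at h1
    rw [ht w ⟨by linarith, by linarith⟩]
    linarith [h1.1]
  · exact ((hf.mem_iff w).2 (Ioo_subset_Ico_self hw)).2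

theorem pow_continuousAt (hf : PiecewiseTranslation f l r F) {w : ℝ} (hw : w ∈ Ioo l r)
    {R : ℕ} (hwF : ∀ i ≤ R, (f ^ i) w ∉ F) :
    ∀ i ≤ R, ContinuousAt (f ^ i : Equiv.Perm ℝ) w ∧ (f ^ i) w ∈ Ioo l r := by
  intro i
  induction i with
  | zero => exact fun _ => ⟨continuousAt_id, by simpa using hw⟩
  | succ i ih =>
    intro hi
    obtain ⟨h1, h2⟩ := ih (by omega)
    obtain ⟨h3, h4⟩ := hf.continuousAt h2 (hwF i (by omega))
    rw [pow_succ', Equiv.Perm.mul_apply, Equiv.Perm.coe_mul]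
    exact ⟨ContinuousAt.comp h3 h1, h4⟩

end PiecewiseTranslation

theorem pow_sub_self_mem_latBall {d : ℤ} {f : Equiv.Perm ℝ} {A : ℕ}
    (hA : ∀ z, f z - z ∈ latBall d A) (k : ℕ) (z : ℝ) :
    (f ^ k) z - z ∈ latBall d (k * A) := by
  induction k with
  | zero => simpa using zero_mem_latBall d 0
  | succ k ih =>
    rw [pow_succ', Equiv.Perm.mul_apply]
    have h := add_mem_latBall (hA ((f ^ k) z)) ih
    rw [sub_add_sub_cancel] at h
    exact latBall_mono (le_of_eq (by ring)) h

theorem Set.Finite.exists_gap {P : Set ℝ} (hP : P.Finite) {u v z : ℝ} (hu : u ∈ P) (hv : v ∈ P)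
    (hz : z ∈ Ico u v) : ∃ a ∈ P, ∃ b ∈ P, u ≤ a ∧ a ≤ z ∧ z < b ∧ b ≤ v ∧
      ∀ y ∈ Ioo a b, y ∉ P := by
  obtain ⟨a, ⟨haP, haz⟩, ha⟩ := (hP.inter_of_left (Iic z)).exists_maximalFor id _ ⟨u, hu, hz.1⟩
  obtain ⟨b, ⟨hbP, hbz⟩, hb⟩ := (hP.inter_of_left (Ioi z)).exists_minimalFor id _ ⟨v, hv, hz.2⟩
  simp only [id, mem_Iic, mem_Ioi] at haz hbz ha hb
  refine ⟨a, haP, b, hbP, ?_, haz, hbz, ?_, ?_⟩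
  · rcases le_total u a with h | h
    · exact h
    · exact ha ⟨hu, hz.1⟩ h
  · rcases le_total b v with h | h
    · exact h
    · exact hb ⟨hv, hz.2⟩ h
  · intro y hy hyP
    rcases le_or_gt y z with h | h
    · exact absurd (ha ⟨hyP, h⟩ hy.1.le) (not_le.2 hy.1)
    · exact absurd (hb ⟨hyP, h⟩ hy.2.le) (not_le.2 hy.2)

theorem sum_length_le_of_pairwise_disjoint {l r : ℝ} (hlr : l ≤ r) (M : ℕ) (a b : ℕ → ℝ)
    (hab : ∀ i, a i ≤ b i) (hsub : ∀ i, Ico (a i) (b i) ⊆ Ico l r)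
    (hdis : Set.PairwiseDisjoint (Finset.range M : Set ℕ) fun i => Ico (a i) (b i)) :
    ∑ i ∈ Finset.range M, (b i - a i) ≤ r - l := by
  have h1 : volume (⋃ i ∈ Finset.range M, Ico (a i) (b i)) =
      ∑ i ∈ Finset.range M, volume (Ico (a i) (b i)) :=
    measure_biUnion_finset hdis (fun i _ => measurableSet_Ico)
  have h2 : volume (⋃ i ∈ Finset.range M, Ico (a i) (b i)) ≤ volume (Ico l r) :=
    measure_mono (iUnion₂_subset fun i _ => hsub i)
  simp only [h1, Real.volume_Ico] at h2
  rw [← ENNReal.ofReal_sum_of_nonneg (fun i _ => sub_nonneg.2 (hab i))] at h2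
  exact (ENNReal.ofReal_le_ofReal_iff (by linarith)).1 h2

theorem log_le_sum_inv (n M : ℕ) (hn : 1 ≤ n) :
    Real.log (((M : ℝ) + n) / n) ≤ ∑ i ∈ Finset.range M, ((i : ℝ) + n)⁻¹ := by
  have hn' : (0 : ℝ) < n := by exact_mod_cast hn
  induction M with
  | zero => simp [hn'.ne']
  | succ M ih =>
    rw [Finset.sum_range_succ]
    have hM : (0 : ℝ) < M + n := by positivity
    have h1 : ((M + 1 : ℕ) + (n : ℝ)) / n = ((M : ℝ) + n) / n * (1 + ((M : ℝ) + n)⁻¹) := by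
      push_cast
      field_simp
      ring
    rw [h1, Real.log_mul (by positivity) (by positivity)]
    have := Real.log_le_sub_one_of_pos (show 0 < 1 + ((M : ℝ) + n)⁻¹ by positivity)
    linarith


theorem mem_latBall_of_pow_mem {d : ℤ} {f : Equiv.Perm ℝ} {A n k : ℕ}
    (hA : ∀ z, f z - z ∈ latBall d A) {z : ℝ} (hz : (f ^ k) z ∈ latBall d n) :
    z ∈ latBall d (n + k * A) := by
  have h := sub_mem_latBall hz (pow_sub_self_mem_latBall hA k z)
  rwa [sub_sub_cancel] at h

/-- The maximal piece around `z ∈ [u,v)` on which the first `i` iterates of `f` are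
translations and have a constant position with respect to `[u,v)`. -/
theorem PiecewiseTranslation.exists_cylinder {d : ℤ} {f : Equiv.Perm ℝ} {l r : ℝ} {F : Set ℝ}
    (hf : PiecewiseTranslation f l r F) {A n : ℕ}
    (hA : ∀ z, f z - z ∈ latBall d A) (hF : F ⊆ latBall d A) {u v z : ℝ} (hlu : l ≤ u)
    (hvr : v ≤ r) (hu : u ∈ latBall d n) (hv : v ∈ latBall d n) (hz : z ∈ Ico u v) (i : ℕ) :
    ∃ a b, u ≤ a ∧ a < b ∧ b ≤ v ∧ b - a ∈ latBall d (2 * (i * A + A + n)) ∧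
      (∃ t, ∀ y ∈ Ico a b, (f ^ i) y = y + t) ∧
      ∀ k ≤ i, ∀ y ∈ Ico a b, (f ^ k) y ∈ Ico u v → (f ^ k) z ∈ Ico u v := by
  set P : Set ℝ := ⋃ k ∈ Finset.range (i + 1), (f ^ k : Equiv.Perm ℝ) ⁻¹' (F ∪ {u, v}) with hPdef
  have hPmem : ∀ y, y ∈ P ↔ ∃ k ≤ i, (f ^ k) y ∈ F ∪ {u, v} := by
    intro y
    simp [hPdef]
  have hPfin : P.Finite := by
    refine Set.Finite.biUnion (Finset.finite_toSet _) fun k _ => ?_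
    exact (hf.finite.union (by simp)).preimage (Equiv.injective _).injOn
  have hPlat : P ⊆ latBall d (i * A + A + n) := by
    intro y hy
    obtain ⟨k, hk, hy⟩ := (hPmem y).1 hy
    have h1 : (f ^ k) y ∈ latBall d (A + n) := by
      rcases hy with h | h | h
      · exact latBall_mono (by omega) (hF h)
      · rw [h]
        exact latBall_mono (by omega) hu
      · rw [mem_singleton_iff.1 h]
        exact latBall_mono (by omega) hv
    have h2 := mem_latBall_of_pow_mem hA h1
    exact latBall_mono (by have := Nat.mul_le_mul_right A hk; omega) h2
  obtain ⟨a, ha, b, hb, hua, haz, hzb, hbv, hgap⟩ := hPfin.exists_gap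
    (u := u) (v := v) (z := z) ((hPmem u).2 ⟨0, by omega, by simp⟩)
    ((hPmem v).2 ⟨0, by omega, by simp⟩) hz
  have hab : a < b := haz.trans_lt hzb
  have hgap' : ∀ k ≤ i, ∀ y ∈ Ioo a b, (f ^ k) y ∉ F ∪ {u, v} := fun k hk y hy h =>
    hgap y hy ((hPmem y).2 ⟨k, hk, h⟩)
  have htr := hf.pow_trans (hlu.trans hua) hab (hbv.trans hvr) (N := i)
    (fun k hk y hy h => hgap' k hk.le y hy (Or.inl h))
  refine ⟨a, b, hua, hab, hbv, ?_, htr i le_rfl, ?_⟩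
  · rw [two_mul]
    exact sub_mem_latBall (hPlat hb) (hPlat ha)
  · intro k hk y hy hyI
    obtain ⟨t, ht⟩ := htr k hk
    rw [ht z ⟨haz, hzb⟩]
    rw [ht y hy] at hyI
    have key : ∀ w ∈ ({u, v} : Set ℝ), w - t ∉ Ioo a b := by
      intro w hw hwt
      apply hgap' k hk _ hwt
      rw [ht _ ⟨hwt.1.le, hwt.2⟩, sub_add_cancel]
      exact Or.inr hw
    have hku := key u (by simp)
    have hkv := key v (by simp)
    by_contra hzI
    rw [mem_Ico, not_and_or, not_le, not_lt] at hzI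
    rcases hzI with h | h
    · exact hku ⟨by linarith, by linarith [hy.2, hyI.1]⟩
    · exact hkv ⟨by linarith [hy.1, hyI.2], by linarith⟩

/-- Semi-intervals of `ℤ[√d]` with endpoints of height at most `n` have return times `O(n)`:
the pieces on which a long excursion is shadowed for time `i` have length at least a multiple
of `1 / (i + n)` and their `i`-th images are disjoint. -/
theorem PiecewiseTranslation.exists_return {d : ℤ} (hd : 0 ≤ d)
    (hirr : Irrational (Real.sqrt d)) {f : Equiv.Perm ℝ} {l r : ℝ} {F : Set ℝ} (hlr : l ≤ r)
    (hf : PiecewiseTranslation f l r F) {A : ℕ} (hA1 : 1 ≤ A)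
    (hA : ∀ z, f z - z ∈ latBall d A) (hF : F ⊆ latBall d A) :
    ∃ C : ℕ, ∀ n, 1 ≤ n → ∀ u v, l ≤ u → v ≤ r → u ∈ latBall d n → v ∈ latBall d n →
      ∀ z ∈ Ico u v, ∃ j, 1 ≤ j ∧ j ≤ C * n ∧ (f ^ j) z ∈ Ico u v := by
  have hs0 := Real.sqrt_nonneg (d : ℝ)
  have hA0 : (1 : ℝ) ≤ A := by exact_mod_cast hA1
  set D : ℝ := 4 * A * (1 + Real.sqrt d) with hD
  have hDpos : 0 < D := by positivity
  obtain ⟨C, hC⟩ := exists_nat_gt (Real.exp ((r - l) * D))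
  refine ⟨C, fun n hn u v hlu hvr hu hv z hz => ?_⟩
  by_contra! hno
  have hn0 : (1 : ℝ) ≤ n := by exact_mod_cast hn
  choose a b hua hab hbv hlat htr hpos using
    hf.exists_cylinder hA hF hlu hvr hu hv hz
  choose t ht using htr
  have himg : ∀ i, ∀ w ∈ Ico (a i + t i) (b i + t i), ∃ y ∈ Ico (a i) (b i), (f ^ i) y = w := by
    intro i w hw
    have hy : w - t i ∈ Ico (a i) (b i) := ⟨by linarith [hw.1], by linarith [hw.2]⟩
    exact ⟨w - t i, hy, by rw [ht i _ hy, sub_add_cancel]⟩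
  have hsubI : ∀ i, Ico (a i) (b i) ⊆ Ico u v := fun i => Ico_subset_Ico (hua i) (hbv i)
  have hsub : ∀ i, Ico (a i + t i) (b i + t i) ⊆ Ico l r := by
    intro i w hw
    obtain ⟨y, hy, rfl⟩ := himg i w hw
    exact hf.pow_mem i (Ico_subset_Ico hlu hvr (hsubI i hy))
  have hdis : ∀ i j, i < j → j < C * n →
      Disjoint (Ico (a i + t i) (b i + t i)) (Ico (a j + t j) (b j + t j)) := by
    intro i j hij hj
    rw [Set.disjoint_left]
    intro w hwi hwj
    obtain ⟨y', hy', h⟩ := himg j w hwj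
    obtain ⟨y, hy, rfl⟩ := himg i w hwi
    have h1 : (f ^ (j - i)) y' = y := by
      apply (f ^ i).injective
      rw [← Equiv.Perm.mul_apply, ← pow_add, ← h]
      congr 2
      omega
    refine hno (j - i) (by omega) (by omega) (hpos j (j - i) (by omega) y' hy' ?_)
    rw [h1]
    exact hsubI i hy
  have hsum := sum_length_le_of_pairwise_disjoint hlr (C * n) (fun i => a i + t i)
    (fun i => b i + t i) (fun i => by have := hab i; linarith) hsub (by
      intro i hi j hj hij
      simp only [Finset.coe_range, mem_Iio] at hi hj
      rcases lt_or_gt_of_ne hij with h | h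
      · exact hdis i j h hj
      · exact (hdis j i h hi).symm)
  have hlen : ∀ i : ℕ, ((i : ℝ) + n)⁻¹ / D ≤ (b i + t i) - (a i + t i) := by
    intro i
    have h1 := one_le_mul_of_mem_latBall hd hirr (hlat i) (sub_pos.2 (hab i))
    push_cast at h1
    have h2 : (2 : ℝ) * (i * A + A + n) ≤ 4 * A * (i + n) := by
      have hi := Nat.cast_nonneg (α := ℝ) i
      nlinarith [mul_nonneg hi (zero_le_one.trans hA0),
        mul_le_mul_of_nonneg_left hn0 (zero_le_one.trans hA0),
        mul_le_mul_of_nonneg_right hA0 (zero_le_one.trans hn0)]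
    have h3 : (b i - a i) * ((2 : ℝ) * (i * A + A + n) * (1 + Real.sqrt d)) ≤
        (b i - a i) * (4 * A * (i + n) * (1 + Real.sqrt d)) := by
      have := hab i
      gcongr
    rw [add_sub_add_right_eq_sub, div_le_iff₀ hDpos, inv_le_iff_one_le_mul₀ (by positivity)]
    calc (1 : ℝ) ≤ _ := h1.trans h3
      _ = _ := by rw [hD]; ring
  have h4 := log_le_sum_inv n (C * n) hn
  have h5 : (∑ i ∈ Finset.range (C * n), ((i : ℝ) + n)⁻¹) / D ≤ r - l := by
    rw [Finset.sum_div]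
    exact (Finset.sum_le_sum fun i _ => hlen i).trans hsum
  rw [div_le_iff₀ hDpos] at h5
  have h6 : (((C * n : ℕ) : ℝ) + n) / n = C + 1 := by
    push_cast
    field_simp
  rw [h6] at h4
  have h7 : (r - l) * D < Real.log (C + 1) := by
    rw [Real.lt_log_iff_exp_lt (by positivity)]
    linarith
  linarith

/-- Every `f`-invariant set with finitely many jumps inside `(l,r)`, all of them in `O`, is
trivial. -/
def OnlyTrivialInvariant (f : Equiv.Perm ℝ) (l r : ℝ) (O : Set ℝ) : Prop :=
  ∀ W : Set ℝ, (∀ z, f z ∈ W ↔ z ∈ W) → (Ioo l r ∩ frontier W).Finite →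
    Ioo l r ∩ frontier W ⊆ O → (W ∩ Ico l r).Nonempty → Ico l r ⊆ W

theorem notMem_frontier_iff {W : Set ℝ} {w : ℝ} :
    w ∉ frontier W ↔ ∀ᶠ y in nhds w, (y ∈ W ↔ w ∈ W) := by
  by_cases h : w ∈ W
  · simp only [h, iff_true, frontier, mem_sdiff, subset_closure h, true_and, not_not]
    exact mem_interior_iff_mem_nhds
  · rw [← frontier_compl]
    simp only [h, iff_false, frontier, mem_sdiff,
      subset_closure (show w ∈ Wᶜ from h), true_and, not_not]
    exact mem_interior_iff_mem_nhds

theorem PiecewiseTranslation.mem_frontier_apply {f : Equiv.Perm ℝ} {l r : ℝ} {F : Set ℝ}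
    (hf : PiecewiseTranslation f l r F) {W : Set ℝ} (hW : ∀ z, f z ∈ W ↔ z ∈ W) {w : ℝ}
    (hw : w ∈ Ioo l r ∩ frontier W) (hwF : w ∉ F) : f w ∈ Ioo l r ∩ frontier W := by
  obtain ⟨hc, hm⟩ := hf.continuousAt hw.1 hwF
  refine ⟨hm, ?_⟩
  by_contra h
  rw [notMem_frontier_iff] at h
  refine (notMem_frontier_iff.2 ?_) hw.2
  filter_upwards [hc.eventually h] with y hy
  rw [← hW y, ← hW w, hy]

/-- Every orbit enters `[x,y)` within the maximal return time. -/
theorem PiecewiseTranslation.exists_hit {f : Equiv.Perm ℝ} {l r : ℝ} {F O : Set ℝ}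
    (hf : PiecewiseTranslation f l r F) (hmin : OnlyTrivialInvariant f l r O)
    (hO : ∀ z, f z ∈ O → z ∈ O) (hFO : F ⊆ O) {x y : ℝ} (hlx : l ≤ x) (hxy : x < y)
    (hyr : y ≤ r) (hx : x ∈ O) (hy : y ∈ O) {R : ℕ}
    (hret : ∀ z ∈ Ico x y, ∃ j, 1 ≤ j ∧ j ≤ R ∧ (f ^ j) z ∈ Ico x y)
    (hret' : ∀ z ∈ Ico x y, ∃ j, 1 ≤ j ∧ j ≤ R ∧ (f⁻¹ ^ j) z ∈ Ico x y) :
    ∀ z ∈ Ico l r, ∃ i ≤ R, (f ^ i) z ∈ Ico x y := by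
  have hOpow : ∀ k z, (f ^ k) z ∈ O → z ∈ O := by
    intro k
    induction k with
    | zero => simp
    | succ k ih =>
      intro z hz
      rw [pow_succ', Equiv.Perm.mul_apply] at hz
      exact ih z (hO _ hz)
  set W : Set ℝ := {z | ∃ i ≤ R, (f ^ i) z ∈ Ico x y} with hWdef
  have hWinv : ∀ z, f z ∈ W ↔ z ∈ W := by
    intro z
    constructor
    · rintro ⟨i, hi, h⟩
      rw [← Equiv.Perm.mul_apply, ← pow_succ] at h
      obtain ⟨j, hj1, hjR, hj⟩ := hret' _ h
      rcases Nat.lt_or_ge i R with hiR | hiR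
      · exact ⟨i + 1, hiR, h⟩
      · refine ⟨i + 1 - j, by omega, ?_⟩
        have h2 : (f⁻¹ ^ j) ((f ^ (i + 1)) z) = (f ^ (i + 1 - j)) z := by
          rw [inv_pow, Equiv.Perm.inv_eq_iff_eq, ← Equiv.Perm.mul_apply, ← pow_add]
          congr 2
          omega
        rwa [h2] at hj
    · rintro ⟨i, hi, h⟩
      rcases Nat.eq_zero_or_pos i with rfl | hi0
      · obtain ⟨j, hj1, hjR, hj⟩ := hret z (by simpa using h)
        refine ⟨j - 1, by omega, ?_⟩
        rw [← Equiv.Perm.mul_apply, ← pow_succ]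
        rwa [Nat.sub_add_cancel hj1]
      · refine ⟨i - 1, by omega, ?_⟩
        rw [← Equiv.Perm.mul_apply, ← pow_succ]
        rwa [Nat.sub_add_cancel hi0]
  have hB : Ioo l r ∩ frontier W ⊆
      ⋃ i ∈ Finset.range (R + 1), (f ^ i : Equiv.Perm ℝ) ⁻¹' (F ∪ {x, y}) := by
    rintro w ⟨hw, hwW⟩
    by_contra hcon
    simp only [mem_iUnion, not_exists, Finset.mem_range, Nat.lt_succ_iff, mem_preimage] at hcon
    have hcont := hf.pow_continuousAt hw (R := R) (fun i hi h => hcon i hi (Or.inl h))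
    refine (notMem_frontier_iff.2 ?_) hwW
    by_cases hwin : w ∈ W
    · obtain ⟨i, hi, h⟩ := hwin
      have hne : (f ^ i) w ≠ x := fun h' => hcon i hi (Or.inr (by simp [h']))
      have hnhds : Ico x y ∈ nhds ((f ^ i) w) :=
        Ico_mem_nhds (lt_of_le_of_ne h.1 hne.symm) h.2
      filter_upwards [(hcont i hi).1.eventually hnhds] with z hz
      exact iff_of_true ⟨i, hi, hz⟩ ⟨i, hi, h⟩
    · have hev : ∀ i ∈ Finset.range (R + 1), ∀ᶠ z in nhds w, (f ^ i) z ∉ Ico x y := by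
        intro i hi
        rw [Finset.mem_range, Nat.lt_succ_iff] at hi
        have h1 : (f ^ i) w ∉ Icc x y := by
          intro h
          rcases h.2.lt_or_eq with h' | h'
          · exact hwin ⟨i, hi, h.1, h'⟩
          · exact hcon i hi (Or.inr (by simp [h']))
        filter_upwards [(hcont i hi).1.eventually (isClosed_Icc.isOpen_compl.mem_nhds h1)]
          with z hz hz'
        exact hz (Ico_subset_Icc_self hz')
      filter_upwards [(Filter.eventually_all_finset _).2 hev] with z hz
      refine iff_of_false ?_ hwin
      rintro ⟨i, hi, h⟩
      exact hz i (Finset.mem_range.2 (Nat.lt_succ_of_le hi)) h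
  have hsub := hmin W hWinv
    (Set.Finite.subset (Set.Finite.biUnion (Finset.finite_toSet _) fun k _ =>
      (hf.finite.union (by simp)).preimage (Equiv.injective _).injOn) hB)
    (by
      intro w hw
      obtain ⟨i, hi⟩ := mem_iUnion.1 (hB hw)
      obtain ⟨-, hi⟩ := mem_iUnion.1 hi
      apply hOpow i
      rcases hi with h | h | h
      · exact hFO h
      · rwa [h]
      · rwa [mem_singleton_iff.1 h])
    ⟨x, ⟨0, by omega, by simpa using hxy⟩, hlx, hxy.trans_le hyr⟩
  exact fun z hz => hsub hz


theorem exists_lt_sub_le_of_injective {l r : ℝ} {n : ℕ} (hn : 1 ≤ n) (p : ℕ → ℝ)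
    (hp : Function.Injective p) (hmem : ∀ k, p k ∈ Ico l r) :
    ∃ i ≤ n, ∃ j ≤ n, p i < p j ∧ p j - p i ≤ (r - l) / n := by
  have hlr : 0 < r - l := sub_pos.2 ((hmem 0).1.trans_lt (hmem 0).2)
  have hn0 : (0 : ℝ) < n := by exact_mod_cast hn
  set g : ℕ → ℕ := fun k => ⌊(p k - l) / ((r - l) / n)⌋₊ with hg
  have hδ : 0 < (r - l) / n := by positivity
  have hmaps : ∀ k ∈ Finset.range (n + 1), g k ∈ Finset.range n := by
    intro k _
    rw [Finset.mem_range, hg, Nat.floor_lt (div_nonneg (sub_nonneg.2 (hmem k).1) hδ.le),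
      div_lt_iff₀ hδ, mul_div_cancel₀ _ hn0.ne']
    linarith [(hmem k).2]
  have key : ∀ i j, g i = g j → p j - p i ≤ (r - l) / n := by
    intro i j h
    have h1 := Nat.lt_floor_add_one ((p j - l) / ((r - l) / n))
    have h2 := Nat.floor_le (div_nonneg (sub_nonneg.2 (hmem i).1) hδ.le)
    rw [div_lt_iff₀ hδ] at h1
    rw [le_div_iff₀ hδ] at h2
    have h3 : ((g i : ℕ) : ℝ) = g j := by rw [h]
    simp only [hg] at h3
    rw [h3] at h2
    linarith
  obtain ⟨i, hi, j, hj, hij, hgij⟩ := Finset.exists_ne_map_eq_of_card_lt_of_maps_to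
    (s := Finset.range (n + 1)) (t := Finset.range n) (by simp) hmaps
  rw [Finset.mem_range, Nat.lt_succ_iff] at hi hj
  rcases lt_or_gt_of_ne (fun h => hij (hp h)) with h | h
  · exact ⟨i, hi, j, hj, h, key i j hgij⟩
  · exact ⟨j, hj, i, hi, h, key j i hgij.symm⟩

/-- A semi-interval on which the first `N` iterates of `f` are continuous has length `O(1 / N)`:
it is carried, in time less than `N`, into a semi-interval of length `O(1 / N)` bounded by
preimages of a discontinuity. -/
theorem PiecewiseTranslation.exists_gap_bound {d : ℤ} (hd : 0 ≤ d)
    (hirr : Irrational (Real.sqrt d)) {f : Equiv.Perm ℝ} {l r : ℝ} {F F' O : Set ℝ}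
    (hf : PiecewiseTranslation f l r F) (hf' : PiecewiseTranslation f⁻¹ l r F') {A : ℕ}
    (hA1 : 1 ≤ A) (hA : ∀ z, f z - z ∈ latBall d A) (hF : F ⊆ latBall d A)
    (hF' : F' ⊆ latBall d A) (hmin : OnlyTrivialInvariant f l r O)
    (hO : ∀ z, f z ∈ O ↔ z ∈ O) (hFO : F ⊆ O) {p : ℝ} (hp : p ∈ F) (hpI : p ∈ Ico l r)
    (hinf : ∀ k : ℕ, (f ^ k) p = p → k = 0) :
    ∃ K : ℝ, ∀ N : ℕ, ∀ u v, l ≤ u → u < v → v ≤ r →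
      (∀ k < N, ∀ z ∈ Ioo u v, (f ^ k) z ∉ F) → (v - u) * N ≤ K := by
  have hlr : l < r := hpI.1.trans_lt hpI.2
  have hA' : ∀ z, f⁻¹ z - z ∈ latBall d A := by
    intro z
    have h := neg_mem_latBall (hA (f⁻¹ z))
    rwa [← Equiv.Perm.mul_apply, mul_inv_cancel, Equiv.Perm.one_apply, neg_sub] at h
  obtain ⟨C₁, hC₁⟩ := hf.exists_return hd hirr hlr.le hA1 hA hF
  obtain ⟨C₂, hC₂⟩ := hf'.exists_return hd hirr hlr.le hA1 hA' hF'
  set E : ℕ := (C₁ + C₂) * (2 * A) + 1 with hE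
  refine ⟨(r - l) * (2 * E), fun N u v hlu huv hvr hN => ?_⟩
  rcases Nat.lt_or_ge N (E + 1) with hNE | hNE
  · have h1 : (N : ℝ) ≤ 2 * E := by exact_mod_cast (by omega : N ≤ 2 * E)
    exact mul_le_mul (by linarith) h1 (Nat.cast_nonneg _) (by linarith)
  set n : ℕ := (N - 1) / E with hn
  have hE0 : 0 < E := by omega
  have hn1 : 1 ≤ n := (Nat.one_le_div_iff hE0).2 (by omega)
  have hnN : E * n < N := by
    have := Nat.mul_div_le (N - 1) E
    rw [← hn] at this
    omega
  have hNn : N ≤ 2 * E * n := by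
    have h1 := Nat.lt_mul_div_succ (N - 1) hE0
    rw [← hn] at h1
    have h2 : E * 1 ≤ E * n := Nat.mul_le_mul_left E hn1
    have h3 : E * (n + 1) = E * n + E := by ring
    have h4 : 2 * E * n = E * n + E * n := by ring
    omega
  set q : ℕ → ℝ := fun k => (f⁻¹ ^ k) p with hq
  have hfq : ∀ k, (f ^ k) (q k) = p := by
    intro k
    simp only [hq]
    rw [← Equiv.Perm.mul_apply, inv_pow, mul_inv_cancel, Equiv.Perm.one_apply]
  have hqmem : ∀ k, q k ∈ Ico l r := fun k => hf'.pow_mem k hpI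
  have hqne : ∀ i j, i < j → q i ≠ q j := by
    intro i j hij h
    have h1 : (f ^ (j - i)) p = p := by
      conv_lhs => rw [← hfq i, h]
      rw [← Equiv.Perm.mul_apply, ← pow_add, Nat.sub_add_cancel hij.le, hfq]
    have := hinf _ h1
    omega
  have hqinj : Function.Injective q := by
    intro i j h
    rcases lt_trichotomy i j with h' | h' | h'
    · exact absurd h (hqne i j h')
    · exact h'
    · exact absurd h.symm (hqne j i h')
  obtain ⟨i, hi, j, hj, hij, hle⟩ := exists_lt_sub_le_of_injective hn1 q hqinj hqmem
  have hqlat : ∀ k ≤ n, q k ∈ latBall d (2 * A * n) := by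
    intro k hk
    have h1 := mem_latBall_of_pow_mem (k := k) hA (z := q k) (by rw [hfq]; exact hF hp)
    refine latBall_mono ?_ h1
    have := Nat.mul_le_mul_right A hk
    have := Nat.mul_le_mul_right A hn1
    nlinarith
  have hqO : ∀ k, q k ∈ O := by
    intro k
    have hpow : ∀ k z, (f ^ k) z ∈ O → z ∈ O := by
      intro k
      induction k with
      | zero => simp
      | succ k ih =>
        intro z hz
        rw [pow_succ', Equiv.Perm.mul_apply, hO] at hz
        exact ih z hz
    exact hpow k _ (by rw [hfq]; exact hFO hp)
  have hlat1 : 1 ≤ 2 * A * n := Nat.mul_pos (by omega) hn1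
  have hR1 : C₁ * (2 * A * n) ≤ (C₁ + C₂) * (2 * A * n) := Nat.mul_le_mul_right _ (by omega)
  have hR2 : C₂ * (2 * A * n) ≤ (C₁ + C₂) * (2 * A * n) := Nat.mul_le_mul_right _ (by omega)
  obtain ⟨e, he, hez⟩ := hf.exists_hit hmin (fun z => (hO z).1) hFO (hqmem i).1 hij (hqmem j).2.le
    (hqO i) (hqO j) (R := (C₁ + C₂) * (2 * A * n))
    (fun z hz => by
      obtain ⟨k, h1, h2, h3⟩ := hC₁ _ hlat1 _ _ (hqmem i).1 (hqmem j).2.le (hqlat i hi)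
        (hqlat j hj) z hz
      exact ⟨k, h1, h2.trans hR1, h3⟩)
    (fun z hz => by
      obtain ⟨k, h1, h2, h3⟩ := hC₂ _ hlat1 _ _ (hqmem i).1 (hqmem j).2.le (hqlat i hi)
        (hqlat j hj) z hz
      exact ⟨k, h1, h2.trans hR2, h3⟩) u ⟨hlu, huv.trans_le hvr⟩
  have heN : ∀ k ≤ n, k + e < N := by
    intro k hk
    have : E * n = (C₁ + C₂) * (2 * A * n) + n := by rw [hE]; ring
    omega
  obtain ⟨t, ht⟩ := hf.pow_trans hlu huv hvr hN e (by have := heN 0 (by omega); omega)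
  have havoid : ∀ k ≤ n, q k ∉ Ioo (u + t) (v + t) := by
    intro k hk hmem
    have hz : q k - t ∈ Ioo u v := ⟨by linarith [hmem.1], by linarith [hmem.2]⟩
    apply hN _ (heN k hk) _ hz
    rw [pow_add, Equiv.Perm.mul_apply, ht _ ⟨hz.1.le, hz.2⟩, sub_add_cancel, hfq]
    exact hp
  rw [ht u ⟨le_rfl, huv⟩] at hez
  have hv : v + t ≤ q j := by
    by_contra! h
    exact havoid j hj ⟨hez.2, h⟩
  have hlen : v - u ≤ (r - l) / n := by linarith [hez.1]
  have hn0 : (0 : ℝ) < n := by exact_mod_cast hn1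
  rw [le_div_iff₀ hn0] at hlen
  have hNn' : (N : ℝ) ≤ 2 * E * n := by exact_mod_cast hNn
  calc (v - u) * N ≤ (v - u) * (2 * E * n) := by
        apply mul_le_mul_of_nonneg_left hNn'
        linarith
    _ = (v - u) * n * (2 * E) := by ring
    _ ≤ (r - l) * (2 * E) := by
        apply mul_le_mul_of_nonneg_right hlen
        positivity

namespace IsIET

variable {s : ℕ} {l r : ℝ} {len : Fin s → ℝ} {π : Equiv.Perm (Fin s)} {T : Equiv.Perm ℝ}

theorem sepPt_add_len (i : Fin s) :
    sepPt l len i + len i = l + ∑ j ∈ Finset.univ.filter (fun j => j ≤ i), len j := by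
  have h : Finset.univ.filter (fun j : Fin s => j ≤ i) =
      insert i (Finset.univ.filter (fun j : Fin s => j < i)) := by
    ext j
    simp [le_iff_eq_or_lt]
  rw [h, Finset.sum_insert (by simp), sepPt]
  ring

theorem imgPt_eq_sepPt (i : Fin s) :
    imgPt l len π i = sepPt l (len ∘ π.symm) (π i) := by
  unfold imgPt sepPt
  congr 1
  exact Finset.sum_equiv π (by simp) (by simp)

theorem le_sepPt (h : IsIET s l r len π T) (i : Fin s) : l ≤ sepPt l len i :=
  le_add_of_nonneg_right (Finset.sum_nonneg fun j _ => (h.2.1 j).le)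

theorem sepPt_add_len_le (h : IsIET s l r len π T) (i : Fin s) :
    sepPt l len i + len i ≤ r := by
  have h1 : ∑ j ∈ Finset.univ.filter (fun j => j ≤ i), len j ≤ ∑ j, len j :=
    Finset.sum_le_sum_of_subset_of_nonneg (Finset.filter_subset _ _) fun j _ _ => (h.2.1 j).le
  rw [sepPt_add_len]
  linarith [h.2.2.1]

theorem sepPt_mem (h : IsIET s l r len π T) (i : Fin s) : sepPt l len i ∈ Ico l r :=
  ⟨h.le_sepPt i, by linarith [h.sepPt_add_len_le i, h.2.1 i]⟩

theorem mem_iff (h : IsIET s l r len π T) (z : ℝ) : T z ∈ Ico l r ↔ z ∈ Ico l r := by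
  by_cases hz : z ∈ Ico l r
  · refine iff_of_true ?_ hz
    by_contra hTz
    have h1 := T.injective (h.2.2.2.1 _ hTz)
    exact hTz (by rw [h1]; exact hz)
  · rw [h.2.2.2.1 z hz]

theorem sepPt_succ {i j : Fin s} (hij : (j : ℕ) = i + 1) :
    sepPt l len j = sepPt l len i + len i := by
  rw [sepPt_add_len, sepPt]
  congr 2
  ext k
  simp only [Finset.mem_filter, Finset.mem_univ, true_and, Fin.lt_def, Fin.le_def]
  omega

theorem exists_mem_Ico_sepPt (h : IsIET s l r len π T) {a : ℝ} (ha : a ∈ Ico l r) :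
    ∃ i, a ∈ Ico (sepPt l len i) (sepPt l len i + len i) ∧
      (sepPt l len i + len i ∈ range (sepPt l len) ∨ sepPt l len i + len i = r) := by
  have hs : 0 < s := by
    rcases Nat.eq_zero_or_pos s with rfl | hs
    · have := h.2.2.1
      simp only [Finset.univ_eq_empty, Finset.sum_empty] at this
      linarith [h.1]
    · exact hs
  obtain ⟨i, hi, himax⟩ := (Finset.univ.filter fun i : Fin s => sepPt l len i ≤ a).exists_maximal
    ⟨⟨0, hs⟩, by
      simp only [Finset.mem_filter, Finset.mem_univ, true_and]
      refine le_trans (le_of_eq ?_) ha.1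
      simp [sepPt, Fin.lt_def]⟩
  simp only [Finset.mem_filter, Finset.mem_univ, true_and] at hi himax
  by_cases hlast : (i : ℕ) + 1 < s
  · have hsucc := sepPt_succ (l := l) (len := len) (i := i) (j := ⟨i + 1, hlast⟩) rfl
    refine ⟨i, ⟨hi, ?_⟩, Or.inl ⟨_, hsucc⟩⟩
    rw [← hsucc]
    by_contra! hle
    have h1 := himax hle (by simp [Fin.le_def])
    simp [Fin.le_def] at h1
  · have huniv : Finset.univ.filter (fun j => j ≤ i) = Finset.univ := by
      ext j
      simp only [Finset.mem_filter, Finset.mem_univ, true_and, Fin.le_def, iff_true]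
      omega
    have h1 : sepPt l len i + len i = r := by
      rw [sepPt_add_len, huniv, h.2.2.1]
      ring
    exact ⟨i, ⟨hi, h1 ▸ ha.2⟩, Or.inr h1⟩

theorem piecewiseTranslation (h : IsIET s l r len π T) :
    PiecewiseTranslation T l r (range (sepPt l len)) where
  finite := finite_range _
  mem_iff := h.mem_iff
  trans := by
    intro a b hla hab hbr hno
    obtain ⟨i, hi, hi'⟩ := h.exists_mem_Ico_sepPt ⟨hla, hab.trans_le hbr⟩
    have hb : b ≤ sepPt l len i + len i := by
      rcases hi' with hi' | hi'
      · by_contra! hlt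
        exact hno _ ⟨hi.2, hlt⟩ hi'
      · exact hi' ▸ hbr
    exact ⟨_, fun z hz => h.2.2.2.2 i z ⟨hi.1.trans hz.1, hz.2.trans_le hb⟩⟩

theorem apply_sepPt (h : IsIET s l r len π T) (i : Fin s) :
    T (sepPt l len i) = imgPt l len π i := by
  rw [h.2.2.2.2 i _ ⟨le_rfl, by linarith [h.2.1 i]⟩]
  ring

theorem inv (h : IsIET s l r len π T) : IsIET s l r (len ∘ π.symm) π.symm T⁻¹ := by
  refine ⟨h.1, fun i => h.2.1 _, ?_, ?_, ?_⟩
  · rw [← h.2.2.1]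
    exact Equiv.sum_comp π.symm len
  · intro z hz
    rw [Equiv.Perm.inv_eq_iff_eq, h.2.2.2.1 z hz]
  · intro i z hz
    obtain ⟨k, rfl⟩ := π.surjective i
    have h1 : imgPt l (len ∘ π.symm) π.symm (π k) = sepPt l len k := by
      rw [imgPt_eq_sepPt]
      simp [Function.comp_assoc]
    rw [← imgPt_eq_sepPt] at hz ⊢
    rw [h1, Equiv.Perm.inv_eq_iff_eq, h.2.2.2.2 k]
    · ring
    · simp only [Function.comp_apply, Equiv.symm_apply_apply] at hz
      exact ⟨by linarith [hz.1], by linarith [hz.2]⟩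

theorem range_sepPt_inv (h : IsIET s l r len π T) :
    range (sepPt l (len ∘ π.symm)) = T '' range (sepPt l len) := by
  rw [← range_comp]
  have h1 : T ∘ sepPt l len = sepPt l (len ∘ π.symm) ∘ π := by
    funext i
    simp [h.apply_sepPt, imgPt_eq_sepPt]
  rw [h1, π.surjective.range_comp]

theorem piecewiseTranslation_inv (h : IsIET s l r len π T) :
    PiecewiseTranslation T⁻¹ l r (T '' range (sepPt l len)) :=
  h.range_sepPt_inv ▸ h.inv.piecewiseTranslation

theorem sepPt_zero (hs : 0 < s) : sepPt l len ⟨0, hs⟩ = l := by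
  simp [sepPt, Fin.lt_def]

theorem zpow_sepPt_eq_self (hreg : IsRegularIET s l len T) {i : Fin s}
    (hi : (i : ℕ) ≠ 0) {k : ℤ} (hk : (T ^ k) (sepPt l len i) = sepPt l len i) : k = 0 := by
  by_contra hk0
  apply hreg.1 i hi
  have hper : ∀ m : ℤ, (T ^ (k * m)) (sepPt l len i) = sepPt l len i := fun m => by
    rw [zpow_mul]
    exact Equiv.Perm.zpow_apply_eq_self_of_apply_eq_self hk m
  refine Set.Finite.subset ((Set.finite_Ico 0 |k|).image fun n : ℤ => (T ^ n) (sepPt l len i)) ?_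
  rintro _ ⟨n, rfl⟩
  refine ⟨n % k, ⟨Int.emod_nonneg n hk0, Int.emod_lt_abs n hk0⟩, ?_⟩
  conv_rhs => rw [← Int.emod_add_mul_ediv n k, zpow_add, Equiv.Perm.mul_apply, hper]

theorem eq_of_zpow_sepPt_eq (hreg : IsRegularIET s l len T) {i j : Fin s}
    (hi : (i : ℕ) ≠ 0) (hj : (j : ℕ) ≠ 0) {k : ℤ}
    (hk : (T ^ k) (sepPt l len j) = sepPt l len i) : i = j ∧ k = 0 := by
  have hij : i = j := by
    by_contra hne
    exact Set.disjoint_left.1 (hreg.2 i j hi hj hne) ⟨0, rfl⟩ ⟨k, hk⟩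
  subst hij
  exact ⟨rfl, zpow_sepPt_eq_self hreg hi hk⟩

/-- The left endpoint is the image of a nonzero separation point. -/
theorem exists_apply_sepPt_eq_left (h : IsIET s l r len π T) (hs : 2 ≤ s)
    (hreg : IsRegularIET s l len T) :
    ∃ q : Fin s, (q : ℕ) ≠ 0 ∧ T (sepPt l len q) = l := by
  refine ⟨π.symm ⟨0, by omega⟩, fun h0 => ?_, ?_⟩
  · have hπ0 : π ⟨0, by omega⟩ = ⟨0, by omega⟩ := by
      rw [← Equiv.eq_symm_apply]
      exact Fin.ext h0.symm
    have hπ1 : ((π.symm ⟨1, hs⟩ : Fin s) : ℕ) ≠ 0 := by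
      intro h1
      have h2 : π.symm ⟨1, hs⟩ = ⟨0, by omega⟩ := Fin.ext h1
      rw [Equiv.symm_apply_eq, hπ0] at h2
      simp at h2
    have hT : (T ^ (1 : ℤ)) (sepPt l len (π.symm ⟨1, hs⟩)) = sepPt l len ⟨1, hs⟩ := by
      rw [zpow_one, h.apply_sepPt, imgPt_eq_sepPt, Equiv.apply_symm_apply,
        sepPt_succ (i := ⟨0, by omega⟩) (j := ⟨1, hs⟩) rfl,
        sepPt_succ (i := ⟨0, by omega⟩) (j := ⟨1, hs⟩) rfl, sepPt_zero, sepPt_zero]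
      rw [Function.comp_apply, (Equiv.symm_apply_eq π).2 hπ0.symm]
    exact one_ne_zero (eq_of_zpow_sepPt_eq hreg (by simp) hπ1 hT).2
  · rw [h.apply_sepPt, imgPt_eq_sepPt, Equiv.apply_symm_apply, sepPt_zero]

/-- A positive iterate of a separation point is never a nonzero separation point. -/
theorem zpow_sepPt_ne (h : IsIET s l r len π T) (hs : 2 ≤ s) (hreg : IsRegularIET s l len T)
    {i j : Fin s} (hi : (i : ℕ) ≠ 0) {k : ℤ} (hk : 0 < k) :
    (T ^ k) (sepPt l len j) ≠ sepPt l len i := by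
  intro heq
  by_cases hj : (j : ℕ) = 0
  · obtain ⟨q, hq, hTq⟩ := h.exists_apply_sepPt_eq_left hs hreg
    have hj0 : j = ⟨0, by omega⟩ := Fin.ext hj
    have hT0 : T (sepPt l len q) = sepPt l len j := by rw [hTq, hj0, sepPt_zero]
    rw [← hT0, ← Equiv.Perm.mul_apply, ← zpow_add_one] at heq
    have := (eq_of_zpow_sepPt_eq hreg hi hq heq).2
    omega
  · have := (eq_of_zpow_sepPt_eq hreg hi hj heq).2
    omega

/-- Points in the orbit of a separation point are not periodic. -/
theorem zpow_apply_eq_self (h : IsIET s l r len π T) (hs : 2 ≤ s)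
    (hreg : IsRegularIET s l len T) {i : Fin s} {w : ℝ} (hw : w ∈ orbitZ T (sepPt l len i))
    {k : ℤ} (hk : (T ^ k) w = w) : k = 0 := by
  obtain ⟨j, hj, m, hm⟩ : ∃ j : Fin s, (j : ℕ) ≠ 0 ∧ ∃ m : ℤ, (T ^ m) (sepPt l len j) = w := by
    obtain ⟨n, rfl⟩ := hw
    by_cases hi : (i : ℕ) = 0
    · obtain ⟨q, hq, hTq⟩ := h.exists_apply_sepPt_eq_left hs hreg
      have hi0 : i = ⟨0, by omega⟩ := Fin.ext hi
      refine ⟨q, hq, n + 1, ?_⟩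
      rw [zpow_add_one, Equiv.Perm.mul_apply, hTq, hi0, sepPt_zero]
    · exact ⟨i, hi, n, rfl⟩
  apply zpow_sepPt_eq_self hreg hj
  apply (T ^ m).injective
  rw [← Equiv.Perm.mul_apply, ← zpow_add, add_comm, zpow_add, Equiv.Perm.mul_apply, hm, hk]

theorem exists_latBall (h : IsIET s l r len π T) {d : ℤ} (hdef : DefinedOverZ d s l r len π) :
    ∃ A : ℕ, 1 ≤ A ∧ r ∈ latBall d A ∧ range (sepPt l len) ⊆ latBall d A ∧
      T '' range (sepPt l len) ⊆ latBall d A ∧ ∀ z, T z - z ∈ latBall d A := by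
  obtain ⟨a, ha⟩ := exists_mem_latBall_of_mem_Zsd hdef.2.1
  choose b hb using fun i => exists_mem_latBall_of_mem_Zsd (hdef.2.2 i).1
  choose c hc using fun i => exists_mem_latBall_of_mem_Zsd (hdef.2.2 i).2
  have hle : ∀ i, b i + c i ≤ ∑ i, (b i + c i) := fun i =>
    Finset.single_le_sum (f := fun i => b i + c i) (fun _ _ => Nat.zero_le _) (Finset.mem_univ i)
  refine ⟨1 + a + ∑ i, (b i + c i), by omega, latBall_mono (by omega) ha, ?_, ?_, ?_⟩
  · rintro _ ⟨i, rfl⟩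
    exact latBall_mono (by have := hle i; omega) (hb i)
  · rintro _ ⟨_, ⟨i, rfl⟩, rfl⟩
    have h1 := add_mem_latBall (hb i) (hc i)
    rw [add_sub_cancel, ← h.apply_sepPt i] at h1
    exact latBall_mono (by have := hle i; omega) h1
  · intro z
    by_cases hz : z ∈ Ico l r
    · obtain ⟨i, hi, -⟩ := h.exists_mem_Ico_sepPt hz
      rw [h.2.2.2.2 i z hi, add_sub_cancel_left]
      exact latBall_mono (by have := hle i; omega) (hc i)
    · rw [h.2.2.2.1 z hz, sub_self]
      exact zero_mem_latBall _ _

/-- Minimality of regular interval exchanges, in the form used here. -/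
theorem onlyTrivialInvariant (h : IsIET s l r len π T) (hs : 2 ≤ s)
    (hreg : IsRegularIET s l len T) :
    OnlyTrivialInvariant T l r (⋃ i, orbitZ T (sepPt l len i)) := by
  intro W hW hfin hsub hne
  have hPT := h.piecewiseTranslation
  have hPT' := h.piecewiseTranslation_inv
  have hW' : ∀ z, T⁻¹ z ∈ W ↔ z ∈ W := fun z => by
    rw [← hW, ← Equiv.Perm.mul_apply, mul_inv_cancel, Equiv.Perm.one_apply]
  have hempty : ∀ w, w ∉ Ioo l r ∩ frontier W := by
    intro w hw
    obtain ⟨i₀, hi₀⟩ := mem_iUnion.1 (hsub hw)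
    have exists_mem : ∀ (S : Equiv.Perm ℝ) (G : Set ℝ), (S = T ∨ S = T⁻¹) →
        (∀ y ∈ Ioo l r ∩ frontier W, y ∉ G → S y ∈ Ioo l r ∩ frontier W) →
        ∃ k : ℕ, (S ^ k) w ∈ Ioo l r ∩ frontier W ∧ (S ^ k) w ∈ G := by
      intro S G hS hstep
      by_contra! hcon
      have hall : ∀ k : ℕ, (S ^ k) w ∈ Ioo l r ∩ frontier W := by
        intro k
        induction k with
        | zero => simpa using hw
        | succ k ih =>
          rw [pow_succ', Equiv.Perm.mul_apply]
          exact hstep _ ih (hcon k ih)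
      have hinj : Function.Injective fun k : ℕ => (S ^ k) w := by
        intro a b hab
        have hT : ∀ a b : ℤ, (T ^ a) w = (T ^ b) w → a = b := by
          intro a b hab
          have h1 : (T ^ (a - b)) w = w := by
            apply (T ^ b).injective
            rw [← hab, ← Equiv.Perm.mul_apply, ← zpow_add, add_sub_cancel]
          exact sub_eq_zero.1 (h.zpow_apply_eq_self hs hreg hi₀ h1)
        rcases hS with rfl | rfl
        · exact_mod_cast hT a b (by simpa using hab)
        · exact_mod_cast neg_inj.1 (hT (-a) (-b) (by simpa using hab))
      exact (Set.infinite_of_injective_forall_mem hinj hall) hfin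
    obtain ⟨k, hkB, i, hki⟩ := exists_mem T _ (Or.inl rfl)
      (fun y hy hyF => hPT.mem_frontier_apply hW hy hyF)
    obtain ⟨k', -, -, ⟨j, rfl⟩, hkj⟩ := exists_mem T⁻¹ _ (Or.inr rfl)
      (fun y hy hyF => hPT'.mem_frontier_apply hW' hy hyF)
    have hi : (i : ℕ) ≠ 0 := by
      intro h0
      have hi0 : i = ⟨0, by omega⟩ := Fin.ext h0
      rw [hi0, sepPt_zero] at hki
      rw [← hki] at hkB
      exact lt_irrefl _ hkB.1.1
    apply h.zpow_sepPt_ne hs hreg hi (j := j) (k := (k : ℤ) + k' + 1) (by positivity)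
    rw [zpow_add_one, Equiv.Perm.mul_apply, hkj, zpow_add, Equiv.Perm.mul_apply, inv_pow,
      zpow_natCast, zpow_natCast, hki, ← Equiv.Perm.mul_apply (T ^ k'), mul_inv_cancel,
      Equiv.Perm.one_apply]
  obtain ⟨q, hq, hTq⟩ := h.exists_apply_sepPt_eq_left hs hreg
  have hl : T l ∈ Ioo l r := by
    have h1 := (h.mem_iff l).2 ⟨le_rfl, h.1⟩
    refine ⟨lt_of_le_of_ne h1.1 fun h2 => ?_, h1.2⟩
    have h3 : (T ^ (1 : ℤ)) (sepPt l len ⟨0, by omega⟩) = sepPt l len ⟨0, by omega⟩ := by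
      rw [sepPt_zero, zpow_one, ← h2]
    exact one_ne_zero (h.zpow_apply_eq_self hs hreg ⟨0, rfl⟩ h3)
  obtain ⟨z, hzW, hz⟩ : ∃ z ∈ W, z ∈ Ioo l r := by
    obtain ⟨z, hzW, hz⟩ := hne
    rcases hz.1.eq_or_lt with h1 | h1
    · exact ⟨T z, (hW z).2 hzW, h1 ▸ hl⟩
    · exact ⟨z, hzW, h1, hz.2⟩
  have hcover : ∀ y ∈ Ioo l r, y ∈ interior W ∨ y ∈ interior Wᶜ := by
    intro y hy
    have h1 : y ∉ frontier W := fun h2 => hempty y ⟨hy, h2⟩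
    rw [notMem_frontier_iff] at h1
    by_cases hyW : y ∈ W
    · left
      rw [mem_interior_iff_mem_nhds]
      filter_upwards [h1] with x hx using hx.2 hyW
    · right
      rw [mem_interior_iff_mem_nhds]
      filter_upwards [h1] with x hx using fun hxW => hyW (hx.1 hxW)
  have hIoo : Ioo l r ⊆ interior W :=
    isPreconnected_Ioo.subset_left_of_subset_union isOpen_interior isOpen_interior
      (disjoint_compl_right.mono interior_subset interior_subset) hcover
      ⟨z, hz, (hcover z hz).resolve_right fun h1 => interior_subset h1 hzW⟩
  intro y hy
  rcases hy.1.eq_or_lt with h1 | h1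
  · rw [← h1, ← hW]
    exact interior_subset (hIoo hl)
  · exact interior_subset (hIoo ⟨h1, hy.2⟩)

end IsIET

theorem apply_mem_orbitZ {T : Equiv.Perm ℝ} {x z : ℝ} : T z ∈ orbitZ T x ↔ z ∈ orbitZ T x := by
  constructor
  · rintro ⟨n, hn⟩
    refine ⟨n - 1, T.injective ?_⟩
    rw [← hn, ← Equiv.Perm.mul_apply, ← zpow_one_add, add_sub_cancel]
  · rintro ⟨n, rfl⟩
    exact ⟨1 + n, by rw [zpow_one_add, Equiv.Perm.mul_apply]⟩

theorem OnlyTrivialInvariant.inv {f : Equiv.Perm ℝ} {l r : ℝ} {O : Set ℝ}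
    (h : OnlyTrivialInvariant f l r O) : OnlyTrivialInvariant f⁻¹ l r O := by
  intro W hW
  refine h W fun z => ?_
  rw [← hW, ← Equiv.Perm.mul_apply, inv_mul_cancel, Equiv.Perm.one_apply]

theorem inv_sub_self_mem_latBall {d : ℤ} {f : Equiv.Perm ℝ} {A : ℕ}
    (hA : ∀ z, f z - z ∈ latBall d A) (z : ℝ) : f⁻¹ z - z ∈ latBall d A := by
  have h := neg_mem_latBall (hA (f⁻¹ z))
  rwa [← Equiv.Perm.mul_apply, mul_inv_cancel, Equiv.Perm.one_apply, neg_sub] at h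

theorem zpow_sub_self_mem_latBall {d : ℤ} {f : Equiv.Perm ℝ} {A : ℕ}
    (hA : ∀ z, f z - z ∈ latBall d A) (k : ℤ) (z : ℝ) :
    (f ^ k) z - z ∈ latBall d (k.natAbs * A) := by
  rcases Int.natAbs_eq k with h | h
  · have h1 := pow_sub_self_mem_latBall hA k.natAbs z
    rwa [← zpow_natCast, ← h] at h1
  · have h1 := pow_sub_self_mem_latBall (inv_sub_self_mem_latBall hA) k.natAbs z
    rwa [← zpow_natCast, inv_zpow', ← h] at h1

theorem psiSet_Ico {d : ℤ} {u v : ℝ} (huv : u < v) :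
    PsiSet d (Ico u v) = max (PsiNum d u) (PsiNum d v) := by
  rw [PsiSet, frontier_Ico huv, image_pair, csSup_pair]

theorem piSet_Ico {d : ℤ} {u v : ℝ} (huv : u < v) :
    PiSet d (Ico u v) = (v - u) * (max (PsiNum d u) (PsiNum d v) : ℕ) := by
  rw [PiSet, psiSet_Ico huv, Real.volume_Ico, ENNReal.toReal_ofReal (sub_nonneg.2 huv.le)]

/-- Lower bound on the reduced complexity of any semi-interval over `ℤ[√d]`. -/
theorem le_piSet_Ico {d : ℤ} (hd : 0 ≤ d) (hirr : Irrational (Real.sqrt d)) {u v : ℝ}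
    (huv : u < v) (hu : u ∈ Zsd d) (hv : v ∈ Zsd d) :
    1 / (2 * (1 + Real.sqrt d)) ≤ PiSet d (Ico u v) := by
  have h := one_le_mul_of_mem_latBall hd hirr
    (sub_mem_latBall (latBall_mono (le_max_right (PsiNum d u) (PsiNum d v)) (mem_latBall_psiNum hv))
      (latBall_mono (le_max_left (PsiNum d u) (PsiNum d v)) (mem_latBall_psiNum hu)))
    (sub_pos.2 huv)
  have h0 := Real.sqrt_nonneg (d : ℝ)
  rw [piSet_Ico huv, div_le_iff₀ (by positivity)]
  refine h.trans (le_of_eq ?_)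
  push_cast
  ring

namespace IsIET

variable {s : ℕ} {l r : ℝ} {len : Fin s → ℝ} {π : Equiv.Perm (Fin s)} {T : Equiv.Perm ℝ}

theorem Dmn_subset_Ico (h : IsIET s l r len π T) {m n : ℕ} : Dmn s l len T m n ⊆ Ico l r := by
  rintro _ ⟨i, k, -, -, rfl⟩
  rcases Int.eq_nat_or_neg k with ⟨a, rfl | rfl⟩
  · rw [zpow_natCast]
    exact h.piecewiseTranslation.pow_mem a (h.sepPt_mem i)
  · rw [zpow_neg, ← inv_zpow, zpow_natCast]
    exact h.piecewiseTranslation_inv.pow_mem a (h.sepPt_mem i)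

theorem Dmn_subset_latBall {d : ℤ} {A : ℕ} (hA : ∀ z, T z - z ∈ latBall d A)
    (hF : range (sepPt l len) ⊆ latBall d A) {m n : ℕ} (hm : 1 ≤ m) :
    Dmn s l len T m n ⊆ latBall d (2 * A * max m n) := by
  rintro _ ⟨i, k, hk, hk', rfl⟩
  have h1 := add_mem_latBall (zpow_sub_self_mem_latBall hA k (sepPt l len i)) (hF ⟨i, rfl⟩)
  rw [sub_add_cancel] at h1
  refine latBall_mono ?_ h1
  have h2 : k.natAbs ≤ max m n := by omega
  have h3 : 1 ≤ max m n := by omega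
  have := Nat.mul_le_mul_right A h2
  have := Nat.mul_le_mul_right A h3
  linarith

/-- Gaps of `D_{m,n}(T)` have length `O(1 / max m n)`. -/
theorem exists_Dmn_gap_bound (h : IsIET s l r len π T) {d : ℤ} (hd : 0 ≤ d)
    (hirr : Irrational (Real.sqrt d)) (hs : 2 ≤ s) (hreg : IsRegularIET s l len T)
    (hdef : DefinedOverZ d s l r len π) :
    ∃ K : ℝ, ∀ m n : ℕ, ∀ u v, l ≤ u → u < v → v ≤ r →
      (∀ w ∈ Dmn s l len T m n, w ∉ Ioo u v) → (v - u) * (max m n : ℕ) ≤ K := by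
  obtain ⟨A, hA1, -, hF, hF', hA⟩ := h.exists_latBall hdef
  have hPT := h.piecewiseTranslation
  have hPT' := h.piecewiseTranslation_inv
  have hmin := h.onlyTrivialInvariant hs hreg
  have hO : ∀ z, T z ∈ (⋃ i, orbitZ T (sepPt l len i)) ↔ z ∈ ⋃ i, orbitZ T (sepPt l len i) := by
    intro z
    simp only [mem_iUnion, apply_mem_orbitZ]
  have hO' : ∀ z, T⁻¹ z ∈ (⋃ i, orbitZ T (sepPt l len i)) ↔
      z ∈ ⋃ i, orbitZ T (sepPt l len i) := by
    intro z
    rw [← hO, ← Equiv.Perm.mul_apply, mul_inv_cancel, Equiv.Perm.one_apply]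
  have hFO : range (sepPt l len) ⊆ ⋃ i, orbitZ T (sepPt l len i) := by
    rintro _ ⟨i, rfl⟩
    exact mem_iUnion.2 ⟨i, 0, rfl⟩
  have hFO' : T '' range (sepPt l len) ⊆ ⋃ i, orbitZ T (sepPt l len i) := by
    rintro _ ⟨z, hz, rfl⟩
    exact (hO z).2 (hFO hz)
  obtain ⟨K, hK⟩ := hPT.exists_gap_bound hd hirr hPT' hA1 hA hF hF' hmin hO hFO
    (p := sepPt l len ⟨1, hs⟩) ⟨_, rfl⟩ (h.sepPt_mem _) (fun k hk => by
      rw [← zpow_natCast] at hk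
      exact_mod_cast h.zpow_apply_eq_self hs hreg ⟨0, rfl⟩ hk)
  obtain ⟨K', hK'⟩ := hPT'.exists_gap_bound hd hirr (by rwa [inv_inv]) hA1
    (inv_sub_self_mem_latBall hA) hF' hF hmin.inv hO' hFO'
    (p := T (sepPt l len ⟨1, hs⟩)) ⟨_, ⟨_, rfl⟩, rfl⟩ ((h.mem_iff _).2 (h.sepPt_mem _))
    (fun k hk => by
      rw [← zpow_natCast, inv_zpow'] at hk
      have h1 := h.zpow_apply_eq_self (i := ⟨1, hs⟩) hs hreg ⟨1, rfl⟩ hk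
      omega)
  refine ⟨max K K', fun m n u v hlu huv hvr hno => ?_⟩
  rcases le_total n m with hmn | hmn
  · rw [max_eq_left hmn]
    refine (hK m u v hlu huv hvr ?_).trans (le_max_left _ _)
    rintro k hk z hz ⟨i, hi⟩
    refine hno z ⟨i, -k, by omega, by omega, ?_⟩ hz
    rw [hi, ← Equiv.Perm.mul_apply, zpow_neg, zpow_natCast, inv_mul_cancel, Equiv.Perm.one_apply]
  · rw [max_eq_right hmn]
    refine (hK' n u v hlu huv hvr ?_).trans (le_max_right _ _)
    rintro k hk z hz ⟨_, ⟨i, rfl⟩, hi⟩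
    refine hno z ⟨i, k + 1, by omega, by omega, ?_⟩ hz
    rw [zpow_add_one, Equiv.Perm.mul_apply, hi, zpow_natCast, inv_pow, ← Equiv.Perm.mul_apply,
      mul_inv_cancel, Equiv.Perm.one_apply]

end IsIET

/-- For a regular `s`-interval exchange transformation defined
over `ℤ[√d]`, `Π(J) = Θ(1)` for every semi-interval `J = [u,v) ∈ U(T)`. -/
theorem piSet_U_theta_one (d : ℤ) (hd : 2 ≤ d) (hsf : Squarefree d)
    (s : ℕ) (hs : 2 ≤ s) (l r : ℝ) (len : Fin s → ℝ) (π : Equiv.Perm (Fin s))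
    (T : Equiv.Perm ℝ) (hIET : IsIET s l r len π T)
    (hreg : IsRegularIET s l len T) (hdef : DefinedOverZ d s l r len π) :
    ∃ c₁ c₂ : ℝ, 0 < c₁ ∧ c₁ ≤ c₂ ∧
      ∀ u v : ℝ, u < v → MemU s l r len T u v →
        c₁ ≤ PiSet d (Set.Ico u v) ∧ PiSet d (Set.Ico u v) ≤ c₂ := by
  have hirr := irrational_sqrt_of_squarefree hd hsf
  have hd0 : 0 ≤ d := by omega
  obtain ⟨A, hA1, hr, hF, -, hA⟩ := hIET.exists_latBall hdef
  obtain ⟨K, hK⟩ := hIET.exists_Dmn_gap_bound hd0 hirr hs hreg hdef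
  have hsqrt := Real.sqrt_nonneg (d : ℝ)
  refine ⟨1 / (2 * (1 + Real.sqrt d)), max (1 / (2 * (1 + Real.sqrt d))) (2 * A * K),
    by positivity, le_max_left _ _, ?_⟩
  rintro u v huv ⟨m, n, hm, hn, hu, hv, hno⟩
  have hub := IsIET.Dmn_subset_latBall hA hF hm hu
  have hvb : v ∈ latBall d (2 * A * max m n) := by
    rcases hv with hv | rfl
    · exact IsIET.Dmn_subset_latBall hA hF hm hv
    · refine latBall_mono ?_ hr
      have h1 : 1 ≤ max m n := by omega
      have := Nat.mul_le_mul_right A h1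
      linarith
  have hvr : v ≤ r := by
    rcases hv with hv | rfl
    · exact (hIET.Dmn_subset_Ico hv).2.le
    · exact le_rfl
  refine ⟨le_piSet_Ico hd0 hirr huv (mem_Zsd_of_mem_latBall hub) (mem_Zsd_of_mem_latBall hvb),
    le_trans ?_ (le_max_right _ _)⟩
  have hgap := hK m n u v (hIET.Dmn_subset_Ico hu).1 huv hvr hno
  have hmax : ((max (PsiNum d u) (PsiNum d v) : ℕ) : ℝ) ≤ (2 * A * max m n : ℕ) :=
    Nat.cast_le.2 (max_le (psiNum_le_of_mem_latBall hub) (psiNum_le_of_mem_latBall hvb))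
  have huv0 : 0 ≤ v - u := sub_nonneg.2 huv.le
  rw [piSet_Ico huv]
  calc (v - u) * (max (PsiNum d u) (PsiNum d v) : ℕ)
      ≤ (v - u) * (2 * A * max m n : ℕ) := mul_le_mul_of_nonneg_left hmax huv0
    _ = 2 * A * ((v - u) * (max m n : ℕ)) := by
        rw [Nat.cast_mul, Nat.cast_mul, Nat.cast_ofNat]
        ring
    _ ≤ 2 * A * K := mul_le_mul_of_nonneg_left hgap (by positivity)

end
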